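/- arXiv:1210.4823 — 2 statements merged into one kernel-verified Lean document; each statement's English description precedes it below -/
import Mathlib

section
/- Fix 1 < R < q and an integer k ≥ 1, and define v̂_k : ℝ² → ℝ in polar coordinates x = r(cos θ, sin θ) by: v̂_k(x) = r^k cos(kθ) for |x| ≤ 1; v̂_k(x) = r^{−k} cos(kθ) for 1 < |x| ≤ R; v̂_k(x) = r^k R^{−2k} cos(kθ) for R < |x| ≤ q; and v̂_k(x) = r^{−k} (q/R)^{2k} cos(kθ) for |x| > q. Let A be the concentric radial coefficient: A = +1 on B_1(0), A = −1 on B_R(0)∖B_1(0), A = +1 outside B_R(0). Then v̂_k is continuous with square-integrable gradient, and for every smooth compactly supported φ : ℝ² → ℝ, ∫_{ℝ²} A ∇v̂_k · ∇φ dx = (2k/q)·q^k·R^{−2k}·∫_{∂B_q(0)} cos(kθ)·φ dH¹. In particular v̂_k satisfies ∇·(A∇v̂_k) = 0 weakly away from ∂B_q(0), with normal-flux jump [ν·∇v̂_k] = −(2k/q) q^k R^{−2k} cos(kθ) across ∂B_q(0). -/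
open MeasureTheory Real Filter

noncomputable section

open scoped Classical

def grad1R (v : ℂ → ℝ) (z : ℂ) : ℝ := fderiv ℝ v z 1

def grad2R (v : ℂ → ℝ) (z : ℂ) : ℝ := fderiv ℝ v z Complex.I

def gradDotR (v φ : ℂ → ℝ) (z : ℂ) : ℝ :=
  grad1R v z * grad1R φ z + grad2R v z * grad2R φ z

def gradSqR (v : ℂ → ℝ) (z : ℂ) : ℝ := grad1R v z ^ 2 + grad2R v z ^ 2

/-- The concentric radial coefficient: `+1` on the closed unit disk, `-1` on the shell
`B_R(0) ∖ B̄_1(0)`, `+1` outside `B_R(0)`. -/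
def coeffRadial (R : ℝ) (z : ℂ) : ℝ :=
  if ‖z‖ ≤ 1 then 1 else if ‖z‖ ≤ R then -1 else 1

def circlePt (q θ : ℝ) : ℂ := (q : ℂ) * Complex.exp ((θ : ℂ) * Complex.I)

/-- The elementary function `v̂_k` used in the primal construction:
`r^k cos(kθ)` for `|x| ≤ 1`, `r^{-k} cos(kθ)` for `1 < |x| ≤ R`,
`r^k R^{-2k} cos(kθ)` for `R < |x| ≤ q`, `r^{-k} (q/R)^{2k} cos(kθ)` for `|x| > q`. -/
def vhat (R q : ℝ) (k : ℕ) (z : ℂ) : ℝ :=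
  if ‖z‖ ≤ 1 then (z ^ k).re
  else if ‖z‖ ≤ R then (z ^ (-(k:ℤ))).re
  else if ‖z‖ ≤ q then (R ^ (2 * k))⁻¹ * (z ^ k).re
  else (q / R) ^ (2 * k) * (z ^ (-(k:ℤ))).re

lemma norm_circlePt {r : ℝ} (hr : 0 ≤ r) (θ : ℝ) : ‖circlePt r θ‖ = r := by
  simp [circlePt, Complex.norm_exp_ofReal_mul_I, abs_of_nonneg hr]

lemma continuous_circlePt : Continuous fun p : ℝ × ℝ => circlePt p.1 p.2 := by
  unfold circlePt
  fun_prop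

/-- The derivative of `(r, θ) ↦ r e^{iθ}`. -/
def circlePtFDeriv (p : ℝ × ℝ) : ℝ × ℝ →L[ℝ] ℂ :=
  (ContinuousLinearMap.fst ℝ ℝ ℝ).smulRight (circlePt 1 p.2) +
    (ContinuousLinearMap.snd ℝ ℝ ℝ).smulRight (Complex.I * circlePt p.1 p.2)

lemma hasFDerivAt_circlePt (p : ℝ × ℝ) :
    HasFDerivAt (fun p : ℝ × ℝ => circlePt p.1 p.2) (circlePtFDeriv p) p := by
  have h1 : HasFDerivAt (fun p : ℝ × ℝ => (p.1 : ℂ)) _ p :=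
    Complex.ofRealCLM.hasFDerivAt.comp p hasFDerivAt_fst
  have h2 : HasFDerivAt (fun p : ℝ × ℝ => (p.2 : ℂ)) _ p :=
    Complex.ofRealCLM.hasFDerivAt.comp p hasFDerivAt_snd
  refine (h1.mul (h2.mul_const Complex.I).cexp).congr_fderiv ?_
  ext
  · simp [circlePtFDeriv, circlePt]
  · simp [circlePtFDeriv, circlePt]
    ring

/-- The derivative of `z ↦ c z ^ n`. -/
def zpowDeriv (c : ℝ) (n : ℤ) (z : ℂ) : ℂ := c * (n * z ^ (n - 1))

lemma hasFDerivAt_re_zpow (c : ℝ) (n : ℤ) (z : ℂ) (h : z ≠ 0 ∨ 0 ≤ n) :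
    HasFDerivAt (fun z : ℂ => c * (z ^ n).re)
      (Complex.reCLM.comp ((ContinuousLinearMap.mul ℝ ℂ) (zpowDeriv c n z))) z := by
  have h1 : HasFDerivAt (fun z : ℂ => c * (z ^ n).re) _ z :=
    (Complex.reCLM.hasFDerivAt.comp z
      ((hasDerivAt_zpow n z h).hasFDerivAt.restrictScalars ℝ)).const_mul c
  refine h1.congr_fderiv ?_
  ext
  simp [zpowDeriv]
  ring

lemma norm_zpowDeriv (c : ℝ) (n : ℤ) (z : ℂ) :
    ‖zpowDeriv c n z‖ = |c| * (|(n : ℝ)| * ‖z‖ ^ (n - 1)) := by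
  simp [zpowDeriv]

lemma mul_conj_zpowDeriv_circlePt (c : ℝ) (n : ℤ) {r : ℝ} (hr : 0 < r) (θ : ℝ) :
    r * (starRingEnd ℂ) (zpowDeriv c n (circlePt r θ)) =
      ((c * n * (r ^ n * cos (n * θ)) : ℝ) : ℂ) * circlePt 1 θ -
        ((c * n * (r ^ (n - 1) * sin (n * θ)) : ℝ) : ℂ) * (Complex.I * circlePt r θ) := by
  have hr' : (r : ℂ) ≠ 0 := by exact_mod_cast hr.ne'
  have h1 : (starRingEnd ℂ) (Complex.exp (θ * Complex.I)) = Complex.exp (-(θ * Complex.I)) := by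
    rw [← Complex.exp_conj]; simp
  have h2 : Complex.exp (-(θ * Complex.I)) ^ (n - 1) =
      Complex.exp (-((n * θ : ℝ) * Complex.I)) * Complex.exp (θ * Complex.I) := by
    rw [← Complex.exp_int_mul, ← Complex.exp_add]; congr 1; push_cast; ring
  have h3 : Complex.exp (-((n * θ : ℝ) * Complex.I)) =
      cos (n * θ) - sin (n * θ) * Complex.I := by
    rw [← neg_mul, Complex.exp_mul_I, Complex.cos_neg, Complex.sin_neg]
    push_cast; ring
  simp only [zpowDeriv, circlePt, map_mul, map_zpow₀, Complex.conj_ofReal, h1, mul_zpow, h2, h3,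
    map_intCast]
  push_cast
  rw [zpow_sub_one₀ hr']
  field_simp

/-- The radial-angular form of `r ∇ Re (z ^ n) · ∇ φ`, up to the factor `n`. -/
def polarFlux (n : ℤ) (φ : ℂ → ℝ) (p : ℝ × ℝ) : ℝ :=
  p.1 ^ n * cos (n * p.2) * fderiv ℝ φ (circlePt p.1 p.2) (circlePt 1 p.2) -
    p.1 ^ (n - 1) * sin (n * p.2) *
      fderiv ℝ φ (circlePt p.1 p.2) (Complex.I * circlePt p.1 p.2)

lemma mul_fderiv_conj_zpowDeriv (c : ℝ) (n : ℤ) (φ : ℂ → ℝ) {r : ℝ} (hr : 0 < r) (θ : ℝ) :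
    r * fderiv ℝ φ (circlePt r θ) ((starRingEnd ℂ) (zpowDeriv c n (circlePt r θ))) =
      c * n * polarFlux n φ (r, θ) := by
  have h := congrArg (fderiv ℝ φ (circlePt r θ)) (mul_conj_zpowDeriv_circlePt c n hr θ)
  rw [map_sub] at h
  simp only [← Complex.real_smul, map_smul, smul_eq_mul] at h
  rw [h, polarFlux]
  ring

/-- The `n`-th cosine moment of `φ` on the circle of radius `r`. -/
def cosMoment (n : ℤ) (φ : ℂ → ℝ) (r : ℝ) : ℝ :=
  ∫ θ in (-π)..π, cos (n * θ) * φ (circlePt r θ)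

lemma continuousOn_polarFlux {n : ℤ} {φ : ℂ → ℝ} (hφ : ContDiff ℝ 1 φ) {s : Set (ℝ × ℝ)}
    (hs : ∀ p ∈ s, p.1 ≠ 0 ∨ 1 ≤ n) : ContinuousOn (polarFlux n φ) s := by
  have hf := hφ.continuous_fderiv one_ne_zero
  have hc := continuous_circlePt
  have hc1 : Continuous fun p : ℝ × ℝ => circlePt 1 p.2 :=
    hc.comp (by fun_prop : Continuous fun p : ℝ × ℝ => ((1 : ℝ), p.2))
  have hz1 : ContinuousOn (fun p : ℝ × ℝ => p.1 ^ n) s :=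
    continuousOn_fst.zpow₀ n fun p hp => (hs p hp).imp id (by omega)
  have hz2 : ContinuousOn (fun p : ℝ × ℝ => p.1 ^ (n - 1)) s :=
    continuousOn_fst.zpow₀ (n - 1) fun p hp => (hs p hp).imp id (by omega)
  have hA : Continuous fun p : ℝ × ℝ =>
      fderiv ℝ φ (circlePt p.1 p.2) (circlePt 1 p.2) := (hf.comp hc).clm_apply hc1
  have hB : Continuous fun p : ℝ × ℝ =>
      fderiv ℝ φ (circlePt p.1 p.2) (Complex.I * circlePt p.1 p.2) :=
    (hf.comp hc).clm_apply (continuous_const.mul hc)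
  unfold polarFlux
  exact ((hz1.mul (by fun_prop)).mul hA.continuousOn).sub
    ((hz2.mul (by fun_prop)).mul hB.continuousOn)

lemma Ioc_prod_Ioo_ae_eq_Icc (a b : ℝ) :
    (Set.Ioc a b ×ˢ Set.Ioo (-π) π : Set (ℝ × ℝ)) =ᵐ[volume] Set.Icc (a, -π) (b, π) := by
  rw [← Set.Icc_prod_Icc]
  exact Measure.set_prod_ae_eq Ioc_ae_eq_Icc Ioo_ae_eq_Icc

lemma integral_polarFlux {n : ℤ} {φ : ℂ → ℝ} (hφ : ContDiff ℝ 1 φ) {a b : ℝ} (ha : 0 ≤ a)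
    (hab : a ≤ b) (hn : 0 < a ∨ 1 ≤ n) :
    IntegrableOn (polarFlux n φ) (Set.Ioc a b ×ˢ Set.Ioo (-π) π) ∧
      ∫ p in Set.Ioc a b ×ˢ Set.Ioo (-π) π, polarFlux n φ p =
        b ^ n * cosMoment n φ b - a ^ n * cosMoment n φ a := by
  have hne : ∀ p ∈ Set.Icc (a, -π) (b, π), p.1 ≠ 0 ∨ 1 ≤ n := fun p hp =>
    hn.imp (fun h => (h.trans_le hp.1.1).ne') id
  have hint : IntegrableOn (polarFlux n φ) (Set.Icc (a, -π) (b, π)) :=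
    (continuousOn_polarFlux hφ hne).integrableOn_compact isCompact_Icc
  refine ⟨hint.congr_set_ae (Ioc_prod_Ioo_ae_eq_Icc a b), ?_⟩
  rw [setIntegral_congr_set (Ioc_prod_Ioo_ae_eq_Icc a b)]
  have hd : Differentiable ℝ φ := hφ.differentiable one_ne_zero
  have hφP : Continuous fun p : ℝ × ℝ => φ (circlePt p.1 p.2) :=
    hφ.continuous.comp continuous_circlePt
  let f : ℝ × ℝ → ℝ := fun p => p.1 ^ n * cos (n * p.2) * φ (circlePt p.1 p.2)
  let g : ℝ × ℝ → ℝ := fun p => -(p.1 ^ (n - 1) * sin (n * p.2)) * φ (circlePt p.1 p.2)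
  let D : ℝ × ℝ → ℝ × ℝ →L[ℝ] ℝ := fun p =>
    (fderiv ℝ φ (circlePt p.1 p.2)).comp (circlePtFDeriv p)
  let dr := ContinuousLinearMap.fst ℝ ℝ ℝ
  let dθ := ContinuousLinearMap.snd ℝ ℝ ℝ
  let f' : ℝ × ℝ → ℝ × ℝ →L[ℝ] ℝ := fun p =>
    (p.1 ^ n * cos (n * p.2)) • D p + φ (circlePt p.1 p.2) •
      (p.1 ^ n • (-sin (n * p.2)) • (n : ℝ) • dθ + cos (n * p.2) • ((n : ℝ) * p.1 ^ (n - 1)) • dr)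
  let g' : ℝ × ℝ → ℝ × ℝ →L[ℝ] ℝ := fun p =>
    (-(p.1 ^ (n - 1) * sin (n * p.2))) • D p + φ (circlePt p.1 p.2) •
      (-(p.1 ^ (n - 1) • cos (n * p.2) • (n : ℝ) • dθ +
        sin (n * p.2) • (((n - 1 : ℤ) : ℝ) * p.1 ^ (n - 1 - 1)) • dr))
  have hdiv : ∀ p, f' p (1, 0) + g' p (0, 1) = polarFlux n φ p := fun p => by
    simp [f', g', D, dr, dθ, circlePtFDeriv, polarFlux]
    ring
  have hD : ∀ p, HasFDerivAt (fun p : ℝ × ℝ => φ (circlePt p.1 p.2)) (D p) p := fun p =>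
    (hd _).hasFDerivAt.comp p (hasFDerivAt_circlePt p)
  have hz : ∀ (m : ℤ) (p : ℝ × ℝ), p.1 ≠ 0 →
      HasFDerivAt (fun p : ℝ × ℝ => p.1 ^ m) (((m : ℝ) * p.1 ^ (m - 1)) • dr) p := fun m p hp =>
    (hasDerivAt_zpow m p.1 (Or.inl hp)).comp_hasFDerivAt p hasFDerivAt_fst
  have hl : ∀ p : ℝ × ℝ, HasFDerivAt (fun p : ℝ × ℝ => (n : ℝ) * p.2) ((n : ℝ) • dθ) p :=
    fun p => hasFDerivAt_snd.const_mul (n : ℝ)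
  have hz1 : ContinuousOn (fun p : ℝ × ℝ => p.1 ^ n) (Set.Icc (a, -π) (b, π)) :=
    continuousOn_fst.zpow₀ n fun p hp => (hne p hp).imp id (by omega)
  have hz2 : ContinuousOn (fun p : ℝ × ℝ => p.1 ^ (n - 1)) (Set.Icc (a, -π) (b, π)) :=
    continuousOn_fst.zpow₀ (n - 1) fun p hp => (hne p hp).imp id (by omega)
  have key := integral_divergence_prod_Icc_of_hasFDerivAt_of_le f g f' g' (a, -π) (b, π)
    ⟨hab, by simp only; linarith [pi_pos]⟩
    ((hz1.mul (by fun_prop)).mul hφP.continuousOn)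
    ((hz2.mul (by fun_prop)).neg.mul hφP.continuousOn)
    (fun p hp => ((hz n p (ha.trans_lt hp.1.1).ne').mul (hl p).cos).mul (hD p))
    (fun p hp => ((hz (n - 1) p (ha.trans_lt hp.1.1).ne').mul (hl p).sin).neg.mul (hD p))
    (hint.congr_fun (fun p _ => (hdiv p).symm) measurableSet_Icc)
  simp only [hdiv] at key
  rw [key]
  simp [f, g, cosMoment, mul_assoc, sin_int_mul_pi]

/-- The complex derivative of the piecewise analytic function whose real part is `vhat`; its
conjugate is the gradient of `vhat`. -/
def vhatDeriv (R q : ℝ) (k : ℕ) (z : ℂ) : ℂ :=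
  if ‖z‖ ≤ 1 then zpowDeriv 1 k z
  else if ‖z‖ ≤ R then zpowDeriv 1 (-k) z
  else if ‖z‖ ≤ q then zpowDeriv (R ^ (2 * k))⁻¹ k z
  else zpowDeriv ((q / R) ^ (2 * k)) (-k) z

lemma re_zpow_neg (z : ℂ) (k : ℕ) :
    (z ^ (-(k : ℤ))).re = (z ^ k).re / ‖z‖ ^ (2 * k) := by
  rw [zpow_neg, zpow_natCast, Complex.inv_re, Complex.normSq_eq_norm_sq, norm_pow, ← pow_mul,
    mul_comm k 2]

lemma vhat_eq_max_min {R q : ℝ} (hR : 1 < R) (hq : R < q) (k : ℕ) (z : ℂ) :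
    vhat R q k z =
      (z ^ k).re / max 1 (min ‖z‖ R) ^ (2 * k) * (q / max q ‖z‖) ^ (2 * k) := by
  have hq0 : q ≠ 0 := by linarith
  unfold vhat
  split_ifs with h1 h2 h3
  · rw [min_eq_left (by linarith), max_eq_left h1, max_eq_left (by linarith)]
    simp [hq0]
  · rw [min_eq_left h2, max_eq_right (by linarith), max_eq_left (by linarith), re_zpow_neg]
    simp [hq0]
  · rw [min_eq_right (by linarith), max_eq_right (by linarith), max_eq_left h3]
    simp [hq0, div_eq_mul_inv, mul_comm]
  · rw [min_eq_right (by linarith), max_eq_right (by linarith), max_eq_right (by linarith),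
      re_zpow_neg]
    simp only [div_pow]
    ring

lemma continuous_vhat {R q : ℝ} (hR : 1 < R) (hq : R < q) (k : ℕ) :
    Continuous (vhat R q k) := by
  have h1 : ∀ z : ℂ, max 1 (min ‖z‖ R) ^ (2 * k) ≠ 0 := fun z =>
    pow_ne_zero _ (lt_of_lt_of_le one_pos (le_max_left _ _)).ne'
  have h2 : ∀ z : ℂ, max q ‖z‖ ≠ 0 := fun z =>
    (lt_of_lt_of_le (by linarith : 0 < q) (le_max_left _ _)).ne'
  rw [funext (vhat_eq_max_min hR hq k)]
  fun_prop (disch := assumption)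

lemma hasFDerivAt_vhat {R q : ℝ} (hR : 1 < R) (hq : R < q) (k : ℕ) {z : ℂ} (h1 : ‖z‖ ≠ 1)
    (h2 : ‖z‖ ≠ R) (h3 : ‖z‖ ≠ q) :
    HasFDerivAt (vhat R q k)
      (Complex.reCLM.comp ((ContinuousLinearMap.mul ℝ ℂ) (vhatDeriv R q k z))) z := by
  have hlt : ∀ {a : ℝ}, ‖z‖ < a → ∀ᶠ w : ℂ in nhds z, ‖w‖ < a := fun h =>
    continuous_norm.continuousAt.eventually_lt continuousAt_const h
  have hgt : ∀ {a : ℝ}, a < ‖z‖ → ∀ᶠ w : ℂ in nhds z, a < ‖w‖ := fun h =>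
    continuousAt_const.eventually_lt continuous_norm.continuousAt h
  have hz : 1 < ‖z‖ → z ≠ 0 := by rintro h rfl; simp at h; linarith
  unfold vhatDeriv
  split_ifs with g1 g2 g3
  · refine (hasFDerivAt_re_zpow 1 k z (Or.inr (by positivity))).congr_of_eventuallyEq ?_
    filter_upwards [hlt (lt_of_le_of_ne g1 h1)] with w hw
    simp [vhat, hw.le]
  · refine (hasFDerivAt_re_zpow 1 (-k) z (Or.inl (hz (by linarith)))).congr_of_eventuallyEq ?_
    filter_upwards [hlt (lt_of_le_of_ne g2 h2), hgt (not_le.1 g1)] with w hw hw'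
    simp [vhat, hw.le, hw'.not_ge]
  · refine (hasFDerivAt_re_zpow _ k z (Or.inr (by positivity))).congr_of_eventuallyEq ?_
    filter_upwards [hlt (lt_of_le_of_ne g3 h3), hgt (not_le.1 g1), hgt (not_le.1 g2)]
      with w hw hw' hw''
    simp [vhat, hw.le, hw'.not_ge, hw''.not_ge]
  · refine (hasFDerivAt_re_zpow _ (-k) z (Or.inl (hz (by linarith)))).congr_of_eventuallyEq ?_
    filter_upwards [hgt (not_le.1 g1), hgt (not_le.1 g2), hgt (not_le.1 g3)] with w hw hw' hw''
    simp [vhat, hw.not_ge, hw'.not_ge, hw''.not_ge]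

lemma gradSqR_eq_of_hasFDerivAt {f : ℂ → ℝ} {w z : ℂ}
    (h : HasFDerivAt f (Complex.reCLM.comp ((ContinuousLinearMap.mul ℝ ℂ) w)) z) :
    gradSqR f z = ‖w‖ ^ 2 := by
  simp [gradSqR, grad1R, grad2R, h.fderiv, ← Complex.normSq_eq_norm_sq, Complex.normSq_apply]
  ring

lemma gradDotR_eq_of_hasFDerivAt {f : ℂ → ℝ} {w z : ℂ} (φ : ℂ → ℝ)
    (h : HasFDerivAt f (Complex.reCLM.comp ((ContinuousLinearMap.mul ℝ ℂ) w)) z) :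
    gradDotR f φ z = fderiv ℝ φ z ((starRingEnd ℂ) w) := by
  have hw : (starRingEnd ℂ) w = w.re • (1 : ℂ) + (-w.im) • Complex.I := by
    apply Complex.ext <;> simp
  rw [hw, map_add, map_smul, map_smul]
  simp [gradDotR, grad1R, grad2R, h.fderiv]

lemma ae_norm_ne (r : ℝ) : ∀ᵐ z : ℂ, ‖z‖ ≠ r := by
  rw [ae_iff]
  simpa [Metric.sphere, dist_zero_right] using Measure.addHaar_sphere volume (0 : ℂ) r

lemma ae_hasFDerivAt_vhat {R q : ℝ} (hR : 1 < R) (hq : R < q) (k : ℕ) :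
    ∀ᵐ z : ℂ, HasFDerivAt (vhat R q k)
      (Complex.reCLM.comp ((ContinuousLinearMap.mul ℝ ℂ) (vhatDeriv R q k z))) z := by
  filter_upwards [ae_norm_ne 1, ae_norm_ne R, ae_norm_ne q] with z h1 h2 h3
    using hasFDerivAt_vhat hR hq k h1 h2 h3

lemma norm_vhatDeriv_mul_le {R q : ℝ} (hR : 1 < R) (hq : R < q) {k : ℕ} (hk : 1 ≤ k) (z : ℂ) :
    ‖vhatDeriv R q k z‖ * (1 + ‖z‖) ^ 2 ≤ k * q ^ (2 * k) * (1 + q) ^ 2 := by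
  have hq1 : 1 ≤ q := by linarith
  have hqk : 1 ≤ q ^ (2 * k) := one_le_pow₀ hq1
  have hkpos : (0 : ℝ) ≤ k := k.cast_nonneg
  have hinv : (R ^ (2 * k))⁻¹ ≤ 1 := inv_le_one_of_one_le₀ (one_le_pow₀ hR.le)
  have hinv0 : 0 ≤ (R ^ (2 * k))⁻¹ := by positivity
  have hz := norm_nonneg z
  have hpos : ((k : ℤ) - 1) = ((k - 1 : ℕ) : ℤ) := by omega
  have hneg : 1 < ‖z‖ → ‖z‖ ^ (-(k : ℤ) - 1) ≤ (‖z‖ ^ 2)⁻¹ := fun h => by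
    rw [← zpow_natCast, ← zpow_neg]
    exact zpow_le_zpow_right₀ h.le (by push_cast; omega)
  unfold vhatDeriv
  split_ifs with h1 h2 h3
  · rw [norm_zpowDeriv, hpos, zpow_natCast]
    have : ‖z‖ ^ (k - 1) ≤ 1 := pow_le_one₀ hz h1
    simp only [abs_one, Int.cast_natCast, Nat.abs_cast, one_mul]
    gcongr
    · exact this.trans hqk
    · linarith
  · rw [norm_zpowDeriv]
    have : ‖z‖ ^ (-(k : ℤ) - 1) ≤ 1 := (hneg (not_le.1 h1)).trans
      (inv_le_one_of_one_le₀ (one_le_pow₀ (not_le.1 h1).le))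
    simp only [abs_one, Int.cast_neg, abs_neg, Int.cast_natCast, Nat.abs_cast, one_mul]
    gcongr
    · exact this.trans hqk
    · linarith
  · rw [norm_zpowDeriv, hpos, zpow_natCast, abs_of_nonneg hinv0]
    have : ‖z‖ ^ (k - 1) ≤ q ^ (2 * k) :=
      (pow_le_pow_left₀ hz h3 _).trans (pow_le_pow_right₀ hq1 (by omega))
    simp only [Int.cast_natCast, Nat.abs_cast]
    refine mul_le_mul ?_ (by gcongr) (by positivity) (by positivity)
    calc (R ^ (2 * k))⁻¹ * (k * ‖z‖ ^ (k - 1)) ≤ 1 * (k * q ^ (2 * k)) := by gcongr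
      _ = _ := one_mul _
  · have hz1 : 1 < ‖z‖ := not_le.1 h1
    have hz0 : 0 < ‖z‖ := by linarith
    rw [norm_zpowDeriv, abs_of_nonneg (by positivity), div_pow]
    simp only [Int.cast_neg, abs_neg, Int.cast_natCast, Nat.abs_cast]
    have hle : (1 + ‖z‖) ^ 2 ≤ ‖z‖ ^ 2 * (1 + q) ^ 2 := by
      rw [← mul_pow]
      gcongr
      nlinarith
    calc q ^ (2 * k) / R ^ (2 * k) * (k * ‖z‖ ^ (-(k : ℤ) - 1)) * (1 + ‖z‖) ^ 2
        ≤ q ^ (2 * k) * 1 * (k * (‖z‖ ^ 2)⁻¹) * (‖z‖ ^ 2 * (1 + q) ^ 2) := by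
          rw [div_eq_mul_inv]
          gcongr
          exact hneg hz1
      _ = k * q ^ (2 * k) * (1 + q) ^ 2 := by
          field_simp

lemma integrable_gradSqR_vhat {R q : ℝ} (hR : 1 < R) (hq : R < q) {k : ℕ} (hk : 1 ≤ k) :
    Integrable (gradSqR (vhat R q k)) volume := by
  have hmeas : Measurable (gradSqR (vhat R q k)) :=
    ((measurable_fderiv_apply_const ℝ (vhat R q k) 1).pow_const 2).add
      ((measurable_fderiv_apply_const ℝ (vhat R q k) Complex.I).pow_const 2)
  have hint : Integrable (fun z : ℂ => (1 + ‖z‖) ^ (-(4 : ℝ))) volume :=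
    integrable_one_add_norm (by rw [Complex.finrank_real_complex]; norm_num)
  refine (hint.const_mul ((k * q ^ (2 * k) * (1 + q) ^ 2) ^ 2)).mono'
    hmeas.aestronglyMeasurable ?_
  filter_upwards [ae_hasFDerivAt_vhat hR hq k] with z hz
  have hpos : 0 < 1 + ‖z‖ := by positivity
  rw [gradSqR_eq_of_hasFDerivAt hz, norm_of_nonneg (by positivity), rpow_neg hpos.le,
    ← div_eq_mul_inv, le_div_iff₀ (by positivity)]
  calc ‖vhatDeriv R q k z‖ ^ 2 * (1 + ‖z‖) ^ (4 : ℝ)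
      = (‖vhatDeriv R q k z‖ * (1 + ‖z‖) ^ 2) ^ 2 := by
        rw [show (4 : ℝ) = ((4 : ℕ) : ℝ) by norm_num, rpow_natCast]; ring
    _ ≤ _ := pow_le_pow_left₀ (by positivity) (norm_vhatDeriv_mul_le hR hq hk z) 2

lemma integral_Ioc_prod_union {H : ℝ × ℝ → ℝ} {t : Set ℝ} (ht : MeasurableSet t) {a b c v w : ℝ}
    (hab : a ≤ b) (hbc : b ≤ c)
    (h1 : IntegrableOn H (Set.Ioc a b ×ˢ t) ∧ ∫ p in Set.Ioc a b ×ˢ t, H p = v)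
    (h2 : IntegrableOn H (Set.Ioc b c ×ˢ t) ∧ ∫ p in Set.Ioc b c ×ˢ t, H p = w) :
    IntegrableOn H (Set.Ioc a c ×ˢ t) ∧ ∫ p in Set.Ioc a c ×ˢ t, H p = v + w := by
  rw [← Set.Ioc_union_Ioc_eq_Ioc hab hbc, Set.union_prod]
  refine ⟨h1.1.union h2.1, ?_⟩
  rw [setIntegral_union _ (measurableSet_Ioc.prod ht) h1.1 h2.1, h1.2, h2.2]
  exact Set.Disjoint.set_prod_left (Set.Ioc_disjoint_Ioc_of_le le_rfl) _ _

lemma integral_Ioc_prod_of_eq_polarFlux {H : ℝ × ℝ → ℝ} {φ : ℂ → ℝ} (hφ : ContDiff ℝ 1 φ) {n : ℤ}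
    {κ a b : ℝ} (ha : 0 ≤ a) (hab : a ≤ b) (hn : 0 < a ∨ 1 ≤ n)
    (hH : ∀ r θ : ℝ, a < r → r ≤ b → H (r, θ) = κ * polarFlux n φ (r, θ)) :
    IntegrableOn H (Set.Ioc a b ×ˢ Set.Ioo (-π) π) ∧
      ∫ p in Set.Ioc a b ×ˢ Set.Ioo (-π) π, H p =
        κ * (b ^ n * cosMoment n φ b - a ^ n * cosMoment n φ a) := by
  have hm : MeasurableSet (Set.Ioc a b ×ˢ Set.Ioo (-π) π) :=
    measurableSet_Ioc.prod measurableSet_Ioo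
  obtain ⟨hi, he⟩ := integral_polarFlux hφ ha hab hn
  have hEq : Set.EqOn H (fun p => κ * polarFlux n φ p) (Set.Ioc a b ×ˢ Set.Ioo (-π) π) :=
    fun p hp => hH p.1 p.2 hp.1.1 hp.1.2
  refine ⟨IntegrableOn.congr_fun (hi.const_mul κ) hEq.symm hm, ?_⟩
  rw [setIntegral_congr_fun hm hEq, integral_const_mul, he]

lemma cosMoment_neg (n : ℤ) (φ : ℂ → ℝ) (r : ℝ) : cosMoment (-n) φ r = cosMoment n φ r := by
  simp [cosMoment]

lemma circlePt_add_two_pi (r θ : ℝ) : circlePt r (θ + 2 * π) = circlePt r θ := by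
  have := Complex.exp_periodic (θ * Complex.I)
  simp only [circlePt]
  rw [← this]
  congr 2
  push_cast
  ring

lemma integral_cos_mul_circlePt (k : ℕ) (φ : ℂ → ℝ) (q : ℝ) :
    ∫ θ in (0 : ℝ)..(2 * π), cos (k * θ) * φ (circlePt q θ) * q = q * cosMoment k φ q := by
  have hper : Function.Periodic (fun θ : ℝ => cos (k * θ) * φ (circlePt q θ)) (2 * π) := fun θ => by
    simp only [circlePt_add_two_pi, mul_add]
    rw [cos_add_nat_mul_two_pi]
  have h := hper.intervalIntegral_add_eq 0 (-π)
  rw [zero_add, show -π + 2 * π = π by ring] at h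
  rw [intervalIntegral.integral_mul_const, h, mul_comm]
  simp [cosMoment]

lemma integral_coeffRadial_mul_gradDotR_vhat {R q : ℝ} (hR : 1 < R) (hq : R < q) {k : ℕ}
    (hk : 1 ≤ k) {φ : ℂ → ℝ} (hφ : ContDiff ℝ 1 φ) (hc : HasCompactSupport φ) :
    ∫ z : ℂ, coeffRadial R z * gradDotR (vhat R q k) φ z =
      2 * k * q ^ k * (R ^ (2 * k))⁻¹ * cosMoment k φ q := by
  obtain ⟨M, hqM, hM⟩ : ∃ M, q < M ∧ tsupport φ ⊆ Metric.ball 0 M := by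
    obtain ⟨M, hM⟩ := hc.isCompact.isBounded.subset_ball (0 : ℂ)
    exact ⟨max M (q + 1), lt_max_of_lt_right (by linarith),
      hM.trans (Metric.ball_subset_ball (le_max_left _ _))⟩
  have hout : ∀ z : ℂ, M ≤ ‖z‖ → z ∉ tsupport φ := fun z hz hmem =>
    hz.not_gt (by simpa using hM hmem)
  have hMmom : cosMoment (-k) φ M = 0 := by
    have : ∀ θ, φ (circlePt M θ) = 0 := fun θ =>
      image_eq_zero_of_notMem_tsupport (hout _ (norm_circlePt (by linarith) θ).ge)
    simp [cosMoment, this]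
  let F : ℂ → ℝ := fun z =>
    coeffRadial R z * fderiv ℝ φ z ((starRingEnd ℂ) (vhatDeriv R q k z))
  let H : ℝ × ℝ → ℝ := fun p => p.1 * F (circlePt p.1 p.2)
  have hF : ∫ z : ℂ, coeffRadial R z * gradDotR (vhat R q k) φ z = ∫ z, F z := by
    refine integral_congr_ae ?_
    filter_upwards [ae_hasFDerivAt_vhat hR hq k] with z hz
    rw [gradDotR_eq_of_hasFDerivAt φ hz]
  have hpolar : ∫ z, F z = ∫ p in Set.Ioc 0 M ×ˢ Set.Ioo (-π) π, H p := by
    have hsymm : ∀ p : ℝ × ℝ, Complex.polarCoord.symm p = circlePt p.1 p.2 := fun p => by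
      rw [Complex.polarCoord_symm_apply, circlePt, Complex.exp_mul_I]
      push_cast; rfl
    rw [← Complex.integral_comp_polarCoord_symm]
    simp only [hsymm, smul_eq_mul]
    refine setIntegral_eq_of_subset_of_forall_sdiff_eq_zero
      (measurableSet_Ioi.prod measurableSet_Ioo)
      (Set.prod_mono (fun r hr => hr.1) subset_rfl) fun p hp => ?_
    have hp0 : 0 < p.1 := hp.1.1
    have hpM : M ≤ p.1 := by
      by_contra! hlt
      exact hp.2 ⟨⟨hp0, hlt.le⟩, hp.1.2⟩
    have hfd : fderiv ℝ φ (circlePt p.1 p.2) = 0 := by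
      by_contra hne
      exact hout _ (hpM.trans (norm_circlePt hp0.le _).ge)
        (support_fderiv_subset ℝ hne)
    simp [F, hfd]
  have h1 := integral_Ioc_prod_of_eq_polarFlux (H := H) (n := k) (κ := k) hφ le_rfl zero_le_one
    (Or.inr (by exact_mod_cast hk)) fun r θ hr hr' => by
      have := mul_fderiv_conj_zpowDeriv 1 k φ hr θ
      simpa [H, F, coeffRadial, vhatDeriv, norm_circlePt hr.le, hr'] using this
  have h2 := integral_Ioc_prod_of_eq_polarFlux (H := H) (n := -k) (κ := k) hφ zero_le_one hR.le
    (Or.inl one_pos) fun r θ hr hr' => by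
      have hr0 : 0 < r := by linarith
      have := mul_fderiv_conj_zpowDeriv 1 (-k) φ hr0 θ
      simp [H, F, coeffRadial, vhatDeriv, norm_circlePt hr0.le, hr', hr.not_ge, this]
  have h3 := integral_Ioc_prod_of_eq_polarFlux (H := H) (n := k) (κ := (R ^ (2 * k))⁻¹ * k) hφ
    (by linarith : 0 ≤ R) hq.le (Or.inl (by linarith)) fun r θ hr hr' => by
      have hr0 : 0 < r := by linarith
      have hr1 : 1 < r := by linarith
      have := mul_fderiv_conj_zpowDeriv (R ^ (2 * k))⁻¹ k φ hr0 θ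
      simp [H, F, coeffRadial, vhatDeriv, norm_circlePt hr0.le, hr', hr.not_ge, hr1.not_ge, this]
  have h4 := integral_Ioc_prod_of_eq_polarFlux (H := H) (n := -k)
    (κ := -((q / R) ^ (2 * k) * k)) hφ
    (by linarith : 0 ≤ q) hqM.le (Or.inl (by linarith)) fun r θ hr hr' => by
      have hr0 : 0 < r := by linarith
      have hr1 : 1 < r := by linarith
      have hr2 : R < r := by linarith
      have := mul_fderiv_conj_zpowDeriv ((q / R) ^ (2 * k)) (-k) φ hr0 θ
      simp [H, F, coeffRadial, vhatDeriv, norm_circlePt hr0.le, hr.not_ge, hr1.not_ge,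
        hr2.not_ge, this]
  have hsum := (integral_Ioc_prod_union measurableSet_Ioo (by linarith) hqM.le
    (integral_Ioc_prod_union measurableSet_Ioo (by linarith) hq.le
      (integral_Ioc_prod_union measurableSet_Ioo zero_le_one hR.le h1 h2) h3) h4).2
  rw [hF, hpolar, hsum, hMmom]
  have hR0 : R ≠ 0 := by linarith
  have hq0 : q ≠ 0 := by linarith
  have hk0 : (k : ℤ) ≠ 0 := by omega
  simp only [cosMoment_neg, zpow_neg, zpow_natCast, one_pow, inv_one, div_pow, zero_zpow _ hk0,
    two_mul, pow_add]
  field_simp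
  ring

/-- `v̂_k` is continuous with square-integrable gradient and satisfies
`∫ A ∇v̂_k·∇φ = (2k/q) q^k R^{-2k} ∫_{∂B_q(0)} cos(kθ) φ dH¹` for all smooth compactly
supported `φ`; i.e. `∇·(A∇v̂_k) = 0` away from `∂B_q(0)` with normal-flux jump
`-(2k/q) q^k R^{-2k} cos(kθ)` across `∂B_q(0)`. -/
theorem vhat_flux_jump
    (R q : ℝ) (hR : 1 < R) (hq : R < q) (k : ℕ) (hk : 1 ≤ k) :
    Continuous (vhat R q k) ∧
    Integrable (gradSqR (vhat R q k)) volume ∧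
    ∀ φ : ℂ → ℝ, ContDiff ℝ (⊤ : ℕ∞) φ → HasCompactSupport φ →
      (∫ z : ℂ, coeffRadial R z * gradDotR (vhat R q k) φ z) =
        (2 * k / q) * q ^ k * (R ^ (2 * k))⁻¹ *
          ∫ θ in (0:ℝ)..(2 * π), Real.cos (k * θ) * φ (circlePt q θ) * q := by
  refine ⟨continuous_vhat hR hq k, integrable_gradSqR_vhat hR hq hk, fun φ hφ hc => ?_⟩
  rw [integral_coeffRadial_mul_gradDotR_vhat hR hq hk (hφ.of_le (by exact_mod_cast le_top)) hc,
    integral_cos_mul_circlePt]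
  have hq0 : q ≠ 0 := by linarith
  field_simp
end
end

section
/- Fix ρ > 0, z₀ ∈ ℂ, and an integer m ≥ 1. Define Ψ_m : ℂ → ℝ by Ψ_m(z) = Re((z − z₀)^m) for |z − z₀| < ρ and Ψ_m(z) = ρ^{2m}·Re((z − z₀)^{−m}) for |z − z₀| ≥ ρ, and define A_{z₀,ρ} : ℂ → ℝ by A_{z₀,ρ} = −1 on B_ρ(z₀) and A_{z₀,ρ} = +1 outside B_ρ(z₀). Then Ψ_m is continuous on ℂ ≡ ℝ², its gradient is square integrable, and Ψ_m is a weak solution of ∇·(A_{z₀,ρ}∇Ψ_m) = 0, i.e. ∫_{ℝ²} A_{z₀,ρ} ∇Ψ_m · ∇φ dx = 0 for every smooth compactly supported φ : ℝ² → ℝ. -/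
open MeasureTheory Real Filter

noncomputable section

open scoped Classical

/-- The perfect plasmon wave `Ψ_m` for the circle `∂B_ρ(z₀)`:
`Re((z-z₀)^m)` for `|z-z₀| < ρ` and `ρ^{2m} Re((z-z₀)^{-m})` for `|z-z₀| ≥ ρ`. -/
def plasmonCentered (ρ : ℝ) (z₀ : ℂ) (m : ℕ) (z : ℂ) : ℝ :=
  if ‖z - z₀‖ < ρ then ((z - z₀) ^ m).re else ρ ^ (2 * m) * ((z - z₀) ^ (-(m:ℤ))).re

/-- The coefficient `A_{z₀,ρ}`: `-1` on `B_ρ(z₀)`, `+1` outside. -/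
def coeffCentered (ρ : ℝ) (z₀ : ℂ) (z : ℂ) : ℝ := if ‖z - z₀‖ < ρ then -1 else 1

section InversionIntoBall

variable {V : Type*} [NormedAddCommGroup V] [InnerProductSpace ℝ V]

/-- The map that fixes the open ball of radius `ρ` about `0` and sends its complement into the
closed ball by inversion in the sphere of radius `ρ`. -/
def invertIntoBall (ρ : ℝ) (x : V) : V := if ‖x‖ < ρ then x else (ρ / ‖x‖) ^ 2 • x

lemma norm_invertIntoBall_le {ρ : ℝ} (hρ : 0 < ρ) (x : V) : ‖invertIntoBall ρ x‖ ≤ ρ := by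
  unfold invertIntoBall
  split_ifs with h
  · exact h.le
  · have hx : 0 < ‖x‖ := hρ.trans_le (not_lt.1 h)
    have : ‖(ρ / ‖x‖) ^ 2 • x‖ = ρ * (ρ / ‖x‖) := by
      rw [norm_smul, norm_pow, Real.norm_of_nonneg (by positivity)]
      field_simp
    rw [this]
    exact mul_le_of_le_one_right hρ.le ((div_le_one hx).2 (not_lt.1 h))

lemma norm_sub_inversion_le {ρ : ℝ} (hρ : 0 < ρ) {x y : V} (hx : ‖x‖ ≤ ρ) (hy : ρ ≤ ‖y‖) :
    ‖x - (ρ / ‖y‖) ^ 2 • y‖ ≤ ‖x - y‖ := by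
  have hy0 : 0 < ‖y‖ := hρ.trans_le hy
  refine le_of_sq_le_sq ?_ (norm_nonneg _)
  rw [norm_sub_sq_real, norm_sub_sq_real, inner_smul_right, norm_smul, norm_pow,
    Real.norm_of_nonneg (by positivity)]
  set t := (ρ / ‖y‖) ^ 2 with ht
  have hty : t * ‖y‖ ^ 2 = ρ ^ 2 := by rw [ht]; field_simp
  have ht1 : t ≤ 1 := by
    rw [ht]
    exact pow_le_one₀ (by positivity) ((div_le_one hy0).2 hy)
  have hin : 2 * inner ℝ x y ≤ ρ ^ 2 + ‖y‖ ^ 2 := by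
    have := sq_nonneg ‖x - y‖
    rw [norm_sub_sq_real] at this
    have : ‖x‖ ^ 2 ≤ ρ ^ 2 := by gcongr
    linarith
  have hkey : 0 ≤ (1 - t) * (ρ ^ 2 + ‖y‖ ^ 2 - 2 * inner ℝ x y) :=
    mul_nonneg (by linarith) (by linarith)
  have hsq : (t * ‖y‖) ^ 2 = t * ρ ^ 2 := by rw [← hty]; ring
  nlinarith [hkey, hty, hsq]

lemma lipschitzWith_invertIntoBall {ρ : ℝ} (hρ : 0 < ρ) :
    LipschitzWith 1 (invertIntoBall ρ : V → V) := by
  refine LipschitzWith.mk_one fun x y => ?_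
  unfold invertIntoBall
  split_ifs with hx hy hy
  · exact le_rfl
  · rw [dist_eq_norm, dist_eq_norm]
    exact norm_sub_inversion_le hρ hx.le (not_lt.1 hy)
  · rw [dist_comm, dist_comm x y, dist_eq_norm, dist_eq_norm]
    exact norm_sub_inversion_le hρ hy.le (not_lt.1 hx)
  · rw [not_lt] at hx hy
    have hx0 : 0 < ‖x‖ := hρ.trans_le hx
    have hy0 : 0 < ‖y‖ := hρ.trans_le hy
    rw [dist_div_norm_sq_smul (norm_pos_iff.1 hx0) (norm_pos_iff.1 hy0)]
    refine mul_le_of_le_one_left dist_nonneg ((div_le_one (by positivity)).2 ?_)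
    rw [sq]
    gcongr

end InversionIntoBall

lemma exists_lipschitzOnWith_pow (m : ℕ) (ρ : ℝ) :
    ∃ C, LipschitzOnWith C (fun w : ℂ => w ^ m) (Metric.closedBall 0 ρ) := by
  refine ⟨m * ρ.toNNReal ^ (m - 1),
    (convex_closedBall (0 : ℂ) ρ).lipschitzOnWith_of_nnnorm_deriv_le
      (fun w _ => differentiableAt_pow m) fun w hw => ?_⟩
  have hw' : ‖w‖₊ ≤ ρ.toNNReal := by
    rw [← NNReal.coe_le_coe]
    exact (mem_closedBall_zero_iff.1 hw).trans (Real.le_coe_toNNReal ρ)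
  simp only [deriv_pow_field, nnnorm_mul, nnnorm_pow]
  gcongr
  exact (NNReal.coe_le_coe.1 (by simp))

/-- The Lipschitz complex function whose real part is the plasmon wave. -/
def plasmonComplex (ρ : ℝ) (z₀ : ℂ) (m : ℕ) (z : ℂ) : ℂ := invertIntoBall ρ (z - z₀) ^ m

lemma exists_lipschitzWith_plasmonComplex {ρ : ℝ} (hρ : 0 < ρ) (z₀ : ℂ) (m : ℕ) :
    ∃ C, LipschitzWith C (plasmonComplex ρ z₀ m) := by
  obtain ⟨C, hC⟩ := exists_lipschitzOnWith_pow m ρ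
  refine ⟨C * 1, lipschitzOnWith_univ.1 (hC.comp
    (g := fun w : ℂ => w ^ m) (f := fun z => invertIntoBall ρ (z - z₀)) ?_ fun z _ =>
      mem_closedBall_zero_iff.2 (norm_invertIntoBall_le hρ _))⟩
  rw [lipschitzOnWith_univ]
  refine LipschitzWith.mk_one fun x y => ?_
  simpa using (lipschitzWith_invertIntoBall hρ).dist_le_mul (x - z₀) (y - z₀)

lemma plasmonComplex_of_norm_lt {ρ : ℝ} {z₀ z : ℂ} (m : ℕ) (h : ‖z - z₀‖ < ρ) :
    plasmonComplex ρ z₀ m z = (z - z₀) ^ m := by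
  simp [plasmonComplex, invertIntoBall, h]

lemma plasmonComplex_of_le_norm {ρ : ℝ} (hρ : 0 < ρ) {z₀ z : ℂ} (m : ℕ) (h : ρ ≤ ‖z - z₀‖) :
    plasmonComplex ρ z₀ m z =
      starRingEnd ℂ ((ρ : ℂ) ^ (2 * m) * (z - z₀) ^ (-(m : ℤ))) := by
  have hw : z - z₀ ≠ 0 := norm_pos_iff.1 (hρ.trans_le h)
  have hcw : starRingEnd ℂ (z - z₀) ≠ 0 := (map_ne_zero _).2 hw
  have hinv : (((ρ / ‖z - z₀‖) ^ 2 : ℝ) : ℂ) * (z - z₀) =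
      (ρ : ℂ) ^ 2 * (starRingEnd ℂ (z - z₀))⁻¹ := by
    push_cast
    rw [div_pow, ← Complex.mul_conj']
    field_simp
  rw [plasmonComplex, invertIntoBall, if_neg (not_lt.2 h), Complex.real_smul, hinv, mul_pow,
    ← pow_mul, map_mul, map_pow, Complex.conj_ofReal, zpow_neg, zpow_natCast, map_inv₀, map_pow,
    inv_pow]

lemma plasmonCentered_eq_re {ρ : ℝ} (hρ : 0 < ρ) (z₀ : ℂ) (m : ℕ) :
    plasmonCentered ρ z₀ m = fun z => (plasmonComplex ρ z₀ m z).re := by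
  funext z
  unfold plasmonCentered
  split_ifs with h
  · rw [plasmonComplex_of_norm_lt m h]
  · rw [plasmonComplex_of_le_norm hρ m (not_lt.1 h), Complex.conj_re, ← Complex.ofReal_pow,
      Complex.re_ofReal_mul]

/-- The Lipschitz stream function of the flux `A ∇Ψ_m`. -/
def plasmonStream (ρ : ℝ) (z₀ : ℂ) (m : ℕ) (z : ℂ) : ℝ := -(plasmonComplex ρ z₀ m z).im

lemma exists_lipschitzWith_plasmonStream {ρ : ℝ} (hρ : 0 < ρ) (z₀ : ℂ) (m : ℕ) :
    ∃ C, LipschitzWith C (plasmonStream ρ z₀ m) := by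
  obtain ⟨C, hC⟩ := exists_lipschitzWith_plasmonComplex hρ z₀ m
  refine ⟨C, LipschitzWith.of_dist_le_mul fun x y => ?_⟩
  refine le_trans ?_ (hC.dist_le_mul x y)
  rw [plasmonStream, plasmonStream, dist_neg_neg, Real.dist_eq, ← Complex.sub_im, dist_eq_norm]
  exact Complex.abs_im_le_norm _

lemma hasFDerivAt_re_of_hasDerivAt {F : ℂ → ℂ} {c z : ℂ} (h : HasDerivAt F c z) :
    HasFDerivAt (fun z => (F z).re)
      (Complex.reCLM.comp (c • (1 : ℂ →L[ℝ] ℂ))) z :=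
  Complex.reCLM.hasFDerivAt.comp z h.complexToReal_fderiv

lemma hasFDerivAt_im_of_hasDerivAt {F : ℂ → ℂ} {c z : ℂ} (h : HasDerivAt F c z) :
    HasFDerivAt (fun z => (F z).im)
      (Complex.imCLM.comp (c • (1 : ℂ →L[ℝ] ℂ))) z :=
  Complex.imCLM.hasFDerivAt.comp z h.complexToReal_fderiv

/-- Inside the ball, `Ψ_m` and its stream function are `Re F` and `-Im F` with
`F = (z - z₀) ^ m`. -/
lemma exists_hasFDerivAt_of_norm_lt {ρ : ℝ} (hρ : 0 < ρ) {z₀ z : ℂ} (m : ℕ)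
    (h : ‖z - z₀‖ < ρ) :
    ∃ c : ℂ, ‖c‖ * (1 + ‖z - z₀‖) ^ 2 ≤ m * ρ ^ (m - 1) * (1 + ρ) ^ 2 ∧
      HasFDerivAt (plasmonCentered ρ z₀ m) (Complex.reCLM.comp (c • (1 : ℂ →L[ℝ] ℂ))) z ∧
      HasFDerivAt (plasmonStream ρ z₀ m) (-(Complex.imCLM.comp (c • (1 : ℂ →L[ℝ] ℂ)))) z := by
  have hev : ∀ᶠ y in nhds z, ‖y - z₀‖ < ρ :=
    (isOpen_lt (by fun_prop) continuous_const).mem_nhds h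
  have hd : HasDerivAt (fun y : ℂ => (y - z₀) ^ m) (m * (z - z₀) ^ (m - 1)) z := by
    simpa using ((hasDerivAt_id z).sub_const z₀).fun_pow m
  refine ⟨m * (z - z₀) ^ (m - 1), ?_, ?_, ?_⟩
  · rw [norm_mul, norm_pow, Complex.norm_natCast]
    gcongr
  · refine (hasFDerivAt_re_of_hasDerivAt hd).congr_of_eventuallyEq ?_
    filter_upwards [hev] with y hy
    simp [plasmonCentered, hy]
  · refine (hasFDerivAt_im_of_hasDerivAt hd).neg.congr_of_eventuallyEq ?_
    filter_upwards [hev] with y hy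
    rw [plasmonStream, plasmonComplex_of_norm_lt m hy, Pi.neg_apply]

/-- Outside the ball, `Ψ_m` and its stream function are `Re F` and `Im F` with
`F = ρ ^ (2 * m) * (z - z₀) ^ (-m)`. -/
lemma exists_hasFDerivAt_of_lt_norm {ρ : ℝ} (hρ : 0 < ρ) {z₀ z : ℂ} {m : ℕ} (hm : 1 ≤ m)
    (h : ρ < ‖z - z₀‖) :
    ∃ c : ℂ, ‖c‖ * (1 + ‖z - z₀‖) ^ 2 ≤ m * ρ ^ (m - 1) * (1 + ρ) ^ 2 ∧
      HasFDerivAt (plasmonCentered ρ z₀ m) (Complex.reCLM.comp (c • (1 : ℂ →L[ℝ] ℂ))) z ∧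
      HasFDerivAt (plasmonStream ρ z₀ m) (Complex.imCLM.comp (c • (1 : ℂ →L[ℝ] ℂ))) z := by
  have hev : ∀ᶠ y in nhds z, ρ < ‖y - z₀‖ :=
    (isOpen_lt continuous_const (by fun_prop)).mem_nhds h
  have hr : 0 < ‖z - z₀‖ := hρ.trans h
  have hw : z - z₀ ≠ 0 := norm_pos_iff.1 hr
  have hd : HasDerivAt (fun y : ℂ => (ρ : ℂ) ^ (2 * m) * (y - z₀) ^ (-(m : ℤ)))
      ((ρ : ℂ) ^ (2 * m) * (-(m : ℂ) * (z - z₀) ^ (-(m : ℤ) - 1))) z := by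
    have := (hasDerivAt_zpow (-(m : ℤ)) (z - z₀) (Or.inl hw)).comp z
      ((hasDerivAt_id z).sub_const z₀)
    simpa using this.const_mul ((ρ : ℂ) ^ (2 * m))
  refine ⟨_, ?_, ?_, (hasFDerivAt_im_of_hasDerivAt hd).congr_of_eventuallyEq ?_⟩
  · obtain ⟨n, rfl⟩ : ∃ n, m = n + 1 := ⟨m - 1, by omega⟩
    have hz : (z - z₀) ^ (-((n + 1 : ℕ) : ℤ) - 1) = ((z - z₀) ^ (n + 2))⁻¹ := by
      rw [← zpow_natCast, ← zpow_neg]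
      congr 1
    rw [hz, norm_mul, norm_mul, norm_neg, Complex.norm_natCast, norm_inv, norm_pow, norm_pow,
      Complex.norm_real, Real.norm_of_nonneg hρ.le, Nat.add_sub_cancel]
    set r := ‖z - z₀‖
    have h1 : ρ ^ n ≤ r ^ n := by gcongr
    have h2 : ρ * (1 + r) ≤ (1 + ρ) * r := by nlinarith
    have h3 : ρ ^ 2 * (1 + r) ^ 2 ≤ (1 + ρ) ^ 2 * r ^ 2 := by
      rw [← mul_pow, ← mul_pow]
      gcongr
    calc ρ ^ (2 * (n + 1)) * (((n + 1 : ℕ) : ℝ) * (r ^ (n + 2))⁻¹) * (1 + r) ^ 2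
        = ((n + 1 : ℕ) : ℝ) * ρ ^ n * (ρ ^ n * (ρ ^ 2 * (1 + r) ^ 2)) / (r ^ n * r ^ 2) := by
          rw [pow_add r n 2]; field_simp; ring
      _ ≤ ((n + 1 : ℕ) : ℝ) * ρ ^ n * (r ^ n * ((1 + ρ) ^ 2 * r ^ 2)) / (r ^ n * r ^ 2) := by
          gcongr
      _ = ((n + 1 : ℕ) : ℝ) * ρ ^ n * (1 + ρ) ^ 2 := by field_simp
  · refine (hasFDerivAt_re_of_hasDerivAt hd).congr_of_eventuallyEq ?_
    filter_upwards [hev] with y hy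
    rw [plasmonCentered, if_neg hy.le.not_gt, ← Complex.ofReal_pow, Complex.re_ofReal_mul]
  · filter_upwards [hev] with y hy
    rw [plasmonStream, plasmonComplex_of_le_norm hρ m hy.le, Complex.conj_im, neg_neg]

lemma ae_norm_sub_ne (ρ : ℝ) (z₀ : ℂ) : ∀ᵐ z : ℂ, ‖z - z₀‖ ≠ ρ := by
  rw [ae_iff]
  have : {z : ℂ | ¬ ‖z - z₀‖ ≠ ρ} = Metric.sphere z₀ ρ := by
    ext z
    simp
  rw [this]
  exact Measure.addHaar_sphere volume z₀ ρ

lemma gradSqR_eq_norm_sq {v : ℂ → ℝ} {c z : ℂ}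
    (h : HasFDerivAt v (Complex.reCLM.comp (c • (1 : ℂ →L[ℝ] ℂ))) z) :
    gradSqR v z = ‖c‖ ^ 2 := by
  rw [gradSqR, grad1R, grad2R, h.fderiv, Complex.sq_norm, Complex.normSq_apply]
  simp
  ring

lemma integrable_gradSqR_plasmonCentered {ρ : ℝ} (hρ : 0 < ρ) (z₀ : ℂ) {m : ℕ} (hm : 1 ≤ m) :
    Integrable (gradSqR (plasmonCentered ρ z₀ m)) volume := by
  have hdom : Integrable (fun z : ℂ => (1 + ‖z - z₀‖) ^ (-(4 : ℝ))) volume :=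
    (integrable_one_add_norm (E := ℂ) (μ := volume) (r := 4)
      (by rw [Complex.finrank_real_complex]; norm_num)).comp_sub_right z₀
  refine (hdom.const_mul ((m * ρ ^ (m - 1) * (1 + ρ) ^ 2) ^ 2)).mono' ?_ ?_
  · exact (((measurable_fderiv_apply_const ℝ _ _).pow_const 2).add
      ((measurable_fderiv_apply_const ℝ _ _).pow_const 2)).aestronglyMeasurable
  · filter_upwards [ae_norm_sub_ne ρ z₀] with z hz
    obtain ⟨c, hc, hd⟩ : ∃ c : ℂ, ‖c‖ * (1 + ‖z - z₀‖) ^ 2 ≤ m * ρ ^ (m - 1) * (1 + ρ) ^ 2 ∧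
        HasFDerivAt (plasmonCentered ρ z₀ m) (Complex.reCLM.comp (c • (1 : ℂ →L[ℝ] ℂ))) z := by
      rcases hz.lt_or_gt with h | h
      · obtain ⟨c, hc, hd, -⟩ := exists_hasFDerivAt_of_norm_lt hρ m h
        exact ⟨c, hc, hd⟩
      · obtain ⟨c, hc, hd, -⟩ := exists_hasFDerivAt_of_lt_norm hρ hm h
        exact ⟨c, hc, hd⟩
    have hpos : 0 < 1 + ‖z - z₀‖ := by positivity
    rw [gradSqR_eq_norm_sq hd, Real.norm_of_nonneg (by positivity), Real.rpow_neg hpos.le,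
      ← div_eq_mul_inv, le_div_iff₀ (by positivity)]
    calc ‖c‖ ^ 2 * (1 + ‖z - z₀‖) ^ (4 : ℝ) = (‖c‖ * (1 + ‖z - z₀‖) ^ 2) ^ 2 := by
          rw [show (4 : ℝ) = ((4 : ℕ) : ℝ) by norm_num, Real.rpow_natCast]; ring
      _ ≤ _ := by gcongr

/-- Almost everywhere, `A ∇Ψ_m` is the gradient of the stream function rotated by a right angle. -/
lemma ae_coeffCentered_mul_gradDotR {ρ : ℝ} (hρ : 0 < ρ) (z₀ : ℂ) {m : ℕ} (hm : 1 ≤ m)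
    (φ : ℂ → ℝ) :
    ∀ᵐ z : ℂ, coeffCentered ρ z₀ z * gradDotR (plasmonCentered ρ z₀ m) φ z =
      lineDeriv ℝ (plasmonStream ρ z₀ m) z Complex.I * grad1R φ z -
        lineDeriv ℝ (plasmonStream ρ z₀ m) z 1 * grad2R φ z := by
  filter_upwards [ae_norm_sub_ne ρ z₀] with z hz
  rcases hz.lt_or_gt with h | h
  · obtain ⟨c, -, hd, hs⟩ := exists_hasFDerivAt_of_norm_lt hρ m h
    rw [hs.differentiableAt.lineDeriv_eq_fderiv, hs.differentiableAt.lineDeriv_eq_fderiv,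
      coeffCentered, if_pos h, gradDotR, grad1R, grad2R, hd.fderiv, hs.fderiv]
    simp
    ring
  · obtain ⟨c, -, hd, hs⟩ := exists_hasFDerivAt_of_lt_norm hρ hm h
    rw [hs.differentiableAt.lineDeriv_eq_fderiv, hs.differentiableAt.lineDeriv_eq_fderiv,
      coeffCentered, if_neg h.le.not_gt, gradDotR, grad1R, grad2R, hd.fderiv, hs.fderiv]
    simp
    ring

/-- A rotated gradient of a Lipschitz function is weakly divergence free. -/
lemma LipschitzWith.integral_lineDeriv_mul_fderiv_sub_eq_zero {E : Type*} [NormedAddCommGroup E]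
    [NormedSpace ℝ E] [FiniteDimensional ℝ E] [MeasurableSpace E] [BorelSpace E]
    {μ : Measure E} [μ.IsAddHaarMeasure] {C : NNReal} {f : E → ℝ} (hf : LipschitzWith C f)
    {φ : E → ℝ} (hφ : ContDiff ℝ 2 φ) (hcs : HasCompactSupport φ) (v w : E) :
    ∫ x, (lineDeriv ℝ f x v * fderiv ℝ φ x w - lineDeriv ℝ f x w * fderiv ℝ φ x v) ∂μ = 0 := by
  have hsmooth : ContDiff ℝ 1 (fderiv ℝ φ) := hφ.fderiv_right (by norm_num)
  have hdir (u : E) : ContDiff ℝ 1 (fun x => fderiv ℝ φ x u) := hsmooth.clm_apply contDiff_const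
  have hsupp (u : E) : HasCompactSupport (fun x => fderiv ℝ φ x u) := hcs.fderiv_apply ℝ u
  have hint (u u' : E) : Integrable (fun x => lineDeriv ℝ f x u * fderiv ℝ φ x u') μ :=
    (hf.locallyIntegrable_lineDeriv u).integrable_smul_right_of_hasCompactSupport
      (hdir u').continuous (hsupp u')
  have hparts (u u' : E) : ∫ x, lineDeriv ℝ f x u * fderiv ℝ φ x u' ∂μ =
      ∫ x, fderiv ℝ (fderiv ℝ φ) x (-u) u' * f x ∂μ := by
    obtain ⟨D, hD⟩ := (hdir u').lipschitzWith_of_hasCompactSupport (hsupp u') one_ne_zero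
    rw [hf.integral_lineDeriv_mul_eq hD (hsupp u') u]
    congr 1 with x
    have hx : DifferentiableAt ℝ (fderiv ℝ φ) x := hsmooth.differentiable one_ne_zero x
    rw [((hdir u').differentiable one_ne_zero x).lineDeriv_eq_fderiv,
      fderiv_clm_apply hx (differentiableAt_const u')]
    simp
  rw [integral_sub (hint v w) (hint w v), hparts, hparts, sub_eq_zero]
  congr 1 with x
  have hsymm : IsSymmSndFDerivAt ℝ φ x := hφ.contDiffAt.isSymmSndFDerivAt (by simp)
  rw [map_neg, map_neg, neg_apply, neg_apply, hsymm v w]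

/-- `Ψ_m` is continuous, has square-integrable gradient, and is a weak
solution of `∇·(A_{z₀,ρ} ∇Ψ_m) = 0`. -/
theorem plasmonCentered_weak_solution (ρ : ℝ) (hρ : 0 < ρ) (z₀ : ℂ) (m : ℕ) (hm : 1 ≤ m) :
    Continuous (plasmonCentered ρ z₀ m) ∧
    Integrable (gradSqR (plasmonCentered ρ z₀ m)) volume ∧
    ∀ φ : ℂ → ℝ, ContDiff ℝ (⊤ : ℕ∞) φ → HasCompactSupport φ →
      (∫ z : ℂ, coeffCentered ρ z₀ z * gradDotR (plasmonCentered ρ z₀ m) φ z) = 0 := by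
  obtain ⟨C, hC⟩ := exists_lipschitzWith_plasmonStream hρ z₀ m
  obtain ⟨K, hK⟩ := exists_lipschitzWith_plasmonComplex hρ z₀ m
  refine ⟨?_, integrable_gradSqR_plasmonCentered hρ z₀ hm, fun φ hφ hcs => ?_⟩
  · rw [plasmonCentered_eq_re hρ]
    exact Complex.continuous_re.comp hK.continuous
  · rw [integral_congr_ae (ae_coeffCentered_mul_gradDotR hρ z₀ hm φ)]
    exact hC.integral_lineDeriv_mul_fderiv_sub_eq_zero
      (contDiff_infty.1 hφ 2) hcs Complex.I 1
end
end
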